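/- arXiv:2307.02156 — 10 statements merged into one kernel-verified Lean document; each statement's English description precedes it below -/
import Mathlib

section
/- For any positive reals N_s, α, n_j, β, γ, there exists a unique θ ∈ (1, ∞) such that N_s = α·n_j·(1/β + 1/γ)·(ln θ + 1/θ − 1). That is, the short-run equilibrium bathtub cost is uniquely determined. -/
theorem bathtub_strict (a b : ℝ) (ha : 1 ≤ a) (hab : a < b) :
    Real.log a + 1 / a - 1 < Real.log b + 1 / b - 1 := by
  have ha0 : 0 < a := by linarith
  have hb0 : 0 < b := by linarith
  have h1 : Real.log (a / b) < a / b - 1 := by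
    apply Real.log_lt_sub_one_of_pos (by positivity)
    intro h
    rw [div_eq_one_iff_eq hb0.ne'] at h
    linarith
  rw [Real.log_div ha0.ne' hb0.ne'] at h1
  have h2 : 1 / a - 1 / b ≤ 1 - a / b := by
    have h3 : (1 - a / b) - (1 / a - 1 / b) = (b - a) * (a - 1) / (a * b) := by
      field_simp
    have h4 : 0 ≤ (b - a) * (a - 1) / (a * b) :=
      div_nonneg (mul_nonneg (by linarith) (by linarith)) (by positivity)
    linarith
  linarith

/-- For any positive reals `N_s, α, n_j, β, γ`, there is a unique `θ ∈ (1, ∞)` with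
`N_s = α n_j (1/β + 1/γ)(ln θ + 1/θ − 1)`: the short-run equilibrium bathtub cost is
uniquely determined. -/
theorem stmt_1 (N_s α n_j β γ : ℝ) (hNs : 0 < N_s) (hα : 0 < α) (hnj : 0 < n_j)
    (hβ : 0 < β) (hγ : 0 < γ) :
    ∃! θ : ℝ, 1 < θ ∧
      N_s = α * n_j * (1 / β + 1 / γ) * (Real.log θ + 1 / θ - 1) := by
  have hK : 0 < α * n_j * (1 / β + 1 / γ) := by positivity
  generalize α * n_j * (1 / β + 1 / γ) = K at hK
  have hc : 0 < N_s / K := by positivity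
  have hle : (1 : ℝ) ≤ Real.exp (N_s / K + 1) := Real.one_le_exp (by linarith)
  have hcont : ContinuousOn (fun θ : ℝ => Real.log θ + 1 / θ - 1)
      (Set.Icc 1 (Real.exp (N_s / K + 1))) := by
    intro x hx
    have hx0 : x ≠ 0 := by have := hx.1; linarith
    apply ContinuousAt.continuousWithinAt
    exact ((Real.continuousAt_log hx0).add
      (continuousAt_const.div continuousAt_id hx0)).sub continuousAt_const
  have hmem : N_s / K ∈ Set.Icc (Real.log 1 + 1 / 1 - 1)
      (Real.log (Real.exp (N_s / K + 1)) + 1 / Real.exp (N_s / K + 1) - 1) := by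
    have hp : 0 < 1 / Real.exp (N_s / K + 1) := by positivity
    rw [Real.log_exp, Real.log_one]
    constructor <;> linarith
  obtain ⟨θ, hθ, hv⟩ := intermediate_value_Icc hle hcont hmem
  simp only at hv
  refine ⟨θ, ⟨lt_of_le_of_ne hθ.1 ?_, ?_⟩, ?_⟩
  · intro h
    rw [← h, Real.log_one] at hv
    linarith
  · rw [hv]
    field_simp
  · rintro y ⟨hy, hye⟩
    have hyv : Real.log y + 1 / y - 1 = N_s / K := by
      rw [eq_div_iff hK.ne', hye]
      ring
    rcases lt_trichotomy y θ with h | h | h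
    · have := bathtub_strict y θ hy.le h
      linarith
    · exact h
    · have := bathtub_strict θ y hθ.1 h
      linarith
end

section
/- The equilibrium bathtub cost strictly decreases when the jam accumulation increases (the network capacity effect of autonomous vehicles): let N_s, α, β, γ, v_f, L be positive reals, let 0 < m₁ < m₂, and let θ₁, θ₂ ∈ (1, ∞) satisfy N_s = α·mᵢ·(1/β + 1/γ)·(ln θᵢ + 1/θᵢ − 1) for i = 1, 2. Then θ₂ < θ₁, and hence the corresponding equilibrium costs satisfy C₂ = θ₂·αL/v_f < θ₁·αL/v_f = C₁. -/
/-- The equilibrium bathtub cost strictly decreases when the jam accumulation increases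
(the network capacity effect of autonomous vehicles): if `0 < m₁ < m₂` and `θᵢ ∈ (1, ∞)`
satisfies `N_s = α mᵢ (1/β + 1/γ)(ln θᵢ + 1/θᵢ − 1)` for `i = 1, 2`, then `θ₂ < θ₁` and the
corresponding equilibrium costs satisfy `θ₂ α L / v_f < θ₁ α L / v_f`. -/
theorem stmt_2 (N_s α β γ v_f L m₁ m₂ θ₁ θ₂ : ℝ)
    (hNs : 0 < N_s) (hα : 0 < α) (hβ : 0 < β) (hγ : 0 < γ) (hvf : 0 < v_f) (hL : 0 < L)
    (hm₁ : 0 < m₁) (hm : m₁ < m₂)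
    (hθ₁ : θ₁ ∈ Set.Ioi (1 : ℝ)) (hθ₂ : θ₂ ∈ Set.Ioi (1 : ℝ))
    (heq₁ : N_s = α * m₁ * (1 / β + 1 / γ) * (Real.log θ₁ + 1 / θ₁ - 1))
    (heq₂ : N_s = α * m₂ * (1 / β + 1 / γ) * (Real.log θ₂ + 1 / θ₂ - 1)) :
    θ₂ < θ₁ ∧ θ₂ * (α * L / v_f) < θ₁ * (α * L / v_f) := by
  have h1 : 1 < θ₁ := hθ₁
  have h2 : 1 < θ₂ := hθ₂
  have p1 : 0 < θ₁ := by linarith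
  have p2 : 0 < θ₂ := by linarith
  have key : θ₂ < θ₁ := by
    by_contra hcon
    have hle : θ₁ ≤ θ₂ := not_lt.mp hcon
    have hlog := Real.one_sub_inv_le_log_of_pos (div_pos p2 p1)
    rw [Real.log_div p2.ne' p1.ne', inv_div] at hlog
    have hineq : 1 / θ₁ - 1 / θ₂ ≤ 1 - θ₁ / θ₂ := by
      have e : 1 - θ₁ / θ₂ - (1 / θ₁ - 1 / θ₂) = (θ₂ - θ₁) * (θ₁ - 1) / (θ₁ * θ₂) := by
        field_simp
      have : 0 ≤ (θ₂ - θ₁) * (θ₁ - 1) / (θ₁ * θ₂) :=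
        div_nonneg (mul_nonneg (by linarith) (by linarith)) (by positivity)
      linarith
    have hg : Real.log θ₁ + 1 / θ₁ - 1 ≤ Real.log θ₂ + 1 / θ₂ - 1 := by linarith
    have hm₂ : 0 < m₂ := hm₁.trans hm
    have hK : 0 < 1 / β + 1 / γ := by positivity
    have hg2 : 0 < Real.log θ₂ + 1 / θ₂ - 1 := by
      rw [heq₂] at hNs
      exact pos_of_mul_pos_right hNs (by positivity)
    have a1 : α * m₁ * (1 / β + 1 / γ) * (Real.log θ₁ + 1 / θ₁ - 1)
        ≤ α * m₁ * (1 / β + 1 / γ) * (Real.log θ₂ + 1 / θ₂ - 1) :=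
      mul_le_mul_of_nonneg_left hg (by positivity)
    have a2 : α * m₁ * (1 / β + 1 / γ) * (Real.log θ₂ + 1 / θ₂ - 1)
        < α * m₂ * (1 / β + 1 / γ) * (Real.log θ₂ + 1 / θ₂ - 1) :=
      mul_lt_mul_of_pos_right
        (mul_lt_mul_of_pos_right (mul_lt_mul_of_pos_left hm hα) hK) hg2
    linarith
  exact ⟨key, mul_lt_mul_of_pos_right key (by positivity)⟩
end

section
/- The normalized equilibrium congestion level θ strictly decreases in the value of travel time α: let N_s, n_j, β, γ be positive reals, let 0 < α₁ < α₂, and let θ₁, θ₂ ∈ (1, ∞) satisfy N_s = αᵢ·n_j·(1/β + 1/γ)·(ln θᵢ + 1/θᵢ − 1) for i = 1, 2. Then θ₂ < θ₁. (Hence reducing α via the VOT effect of autonomous vehicles raises θ, i.e., worsens the capacity drop, so the equilibrium cost C = θ·αL/v_f may rise or fall.) -/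
/-- The normalized equilibrium congestion level `θ` strictly decreases in the value of travel
time `α`: if `0 < α₁ < α₂` and `θᵢ ∈ (1, ∞)` satisfies
`N_s = αᵢ n_j (1/β + 1/γ)(ln θᵢ + 1/θᵢ − 1)` for `i = 1, 2`, then `θ₂ < θ₁`. -/
theorem stmt_3 (N_s n_j β γ α₁ α₂ θ₁ θ₂ : ℝ)
    (hNs : 0 < N_s) (hnj : 0 < n_j) (hβ : 0 < β) (hγ : 0 < γ)
    (hα₁ : 0 < α₁) (hα : α₁ < α₂)
    (hθ₁ : θ₁ ∈ Set.Ioi (1 : ℝ)) (hθ₂ : θ₂ ∈ Set.Ioi (1 : ℝ))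
    (heq₁ : N_s = α₁ * n_j * (1 / β + 1 / γ) * (Real.log θ₁ + 1 / θ₁ - 1))
    (heq₂ : N_s = α₂ * n_j * (1 / β + 1 / γ) * (Real.log θ₂ + 1 / θ₂ - 1)) :
    θ₂ < θ₁ := by
  have h1 : 1 < θ₁ := hθ₁
  have h2 : 1 < θ₂ := hθ₂
  have p1 : 0 < θ₁ := by linarith
  have p2 : 0 < θ₂ := by linarith
  by_contra hcon
  have hle : θ₁ ≤ θ₂ := not_lt.mp hcon
  have hlog : 1 - θ₁ / θ₂ ≤ Real.log θ₂ - Real.log θ₁ := by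
    have h := Real.one_sub_inv_le_log_of_pos (div_pos p2 p1)
    rwa [Real.log_div p2.ne' p1.ne', inv_div] at h
  have hd : 1 / θ₁ - 1 / θ₂ ≤ 1 - θ₁ / θ₂ := by
    have e : (1 - θ₁ / θ₂) - (1 / θ₁ - 1 / θ₂) = (θ₂ - θ₁) * (θ₁ - 1) / (θ₁ * θ₂) := by
      field_simp
    have : 0 ≤ (θ₂ - θ₁) * (θ₁ - 1) / (θ₁ * θ₂) :=
      div_nonneg (mul_nonneg (by linarith) (by linarith)) (by positivity)
    linarith
  have hg : Real.log θ₁ + 1 / θ₁ - 1 ≤ Real.log θ₂ + 1 / θ₂ - 1 := by linarith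
  generalize Real.log θ₁ + 1 / θ₁ - 1 = a at *
  generalize Real.log θ₂ + 1 / θ₂ - 1 = b at *
  have hK : 0 < n_j * (1 / β + 1 / γ) := by positivity
  have e1 : N_s = α₁ * (n_j * (1 / β + 1 / γ)) * a := by rw [heq₁]; ring
  have e2 : N_s = α₂ * (n_j * (1 / β + 1 / γ)) * b := by rw [heq₂]; ring
  generalize n_j * (1 / β + 1 / γ) = K at *
  have hα₂ : 0 < α₂ := hα₁.trans hα
  have hb : 0 < b := by
    have : 0 < α₂ * K * b := e2 ▸ hNs
    exact (mul_pos_iff_of_pos_left (mul_pos hα₂ hK)).mp this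
  have s1 : α₁ * K * a ≤ α₁ * K * b := mul_le_mul_of_nonneg_left hg (mul_pos hα₁ hK).le
  have s2 : α₁ * K * b < α₂ * K * b :=
    mul_lt_mul_of_pos_right (mul_lt_mul_of_pos_right hα hK) hb
  linarith
end

section
/- Along the early-arrival equilibrium accumulation path, the downtown travel time rises at the constant rate β/α: let α, β, v_f, L, n_j be positive reals, set a = β·v_f/(α·L), and for t ≥ t_s let n(t) = n_j·(1 − 1/(1 + a·(t − t_s))) and T(t) = L/(v_f·(1 − n(t)/n_j)). Then T is differentiable with dT/dt = β/α for all t > t_s. -/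
/-- Along the early-arrival equilibrium accumulation path, the downtown travel time rises at
the constant rate `β/α`: with `a = β v_f/(α L)`, `n(t) = n_j (1 − 1/(1 + a (t − t_s)))` and
`T(t) = L/(v_f (1 − n(t)/n_j))`, the travel time `T` is differentiable with derivative `β/α`
at every `t > t_s`. -/
theorem stmt_5 (α β v_f L n_j t_s a : ℝ)
    (hα : 0 < α) (hβ : 0 < β) (hvf : 0 < v_f) (hL : 0 < L) (hnj : 0 < n_j)
    (ha : a = β * v_f / (α * L)) :
    ∀ t : ℝ, t_s < t →
      HasDerivAt
        (fun t : ℝ => L / (v_f * (1 - (n_j * (1 - 1 / (1 + a * (t - t_s)))) / n_j)))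
        (β / α) t := by
  intro t _
  have hfun : (fun t : ℝ => L / (v_f * (1 - (n_j * (1 - 1 / (1 + a * (t - t_s)))) / n_j)))
      = fun t : ℝ => L / v_f * (1 + a * (t - t_s)) := by
    funext s
    rw [mul_div_cancel_left₀ _ hnj.ne', sub_sub_cancel, one_div, ← div_div, div_inv_eq_mul]
  rw [hfun]
  have hd := ((((hasDerivAt_id t).sub_const t_s).const_mul a).const_add 1).const_mul (L / v_f)
  have hval : L / v_f * (a * 1) = β / α := by
    rw [ha]
    field_simp
  rw [hval] at hd
  exact hd
end

section
/- The cumulative outflow over the early-arrival period equals (α·n_j/β)·(ln θ + 1/θ − 1): let α, β, v_f, L, n_j be positive reals, set a = β·v_f/(α·L), let θ > 1, and let t* satisfy a·(t* − t_s) = θ − 1. With n(t) = n_j·(1 − 1/(1 + a·(t − t_s))) and v(t) = v_f·(1 − n(t)/n_j), one has ∫_{t_s}^{t*} n(t)·v(t)/L dt = (α·n_j/β)·(ln θ + 1/θ − 1). -/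
/-- The cumulative outflow over the early-arrival period equals
`(α n_j/β)(ln θ + 1/θ − 1)`: with `a = β v_f/(α L)`, `θ > 1`, `a (t* − t_s) = θ − 1`,
`n(t) = n_j (1 − 1/(1 + a (t − t_s)))` and `v(t) = v_f (1 − n(t)/n_j)`, one has
`∫_{t_s}^{t*} n(t) v(t)/L dt = (α n_j/β)(ln θ + 1/θ − 1)`. -/
theorem stmt_6 (α β v_f L n_j t_s tstar a θ : ℝ)
    (hα : 0 < α) (hβ : 0 < β) (hvf : 0 < v_f) (hL : 0 < L) (hnj : 0 < n_j)
    (ha : a = β * v_f / (α * L)) (hθ : 1 < θ) (hts : a * (tstar - t_s) = θ - 1) :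
    ∫ t in t_s..tstar,
        (n_j * (1 - 1 / (1 + a * (t - t_s)))) *
          (v_f * (1 - (n_j * (1 - 1 / (1 + a * (t - t_s)))) / n_j)) / L
      = α * n_j / β * (Real.log θ + 1 / θ - 1) := by
  have ha0 : 0 < a := by rw [ha]; positivity
  have hlt : t_s ≤ tstar := by
    by_contra! h
    nlinarith
  have hpos : ∀ t ∈ Set.uIcc t_s tstar, 0 < 1 + a * (t - t_s) := by
    intro t ht
    rw [Set.uIcc_of_le hlt] at ht
    have := mul_nonneg ha0.le (sub_nonneg.mpr ht.1)
    linarith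
  have hF : ∀ t ∈ Set.uIcc t_s tstar,
      HasDerivAt (fun t => α * n_j / β *
        (Real.log (1 + a * (t - t_s)) + (1 + a * (t - t_s))⁻¹))
        ((n_j * (1 - 1 / (1 + a * (t - t_s)))) *
          (v_f * (1 - (n_j * (1 - 1 / (1 + a * (t - t_s)))) / n_j)) / L) t := by
    intro t ht
    have hu := hpos t ht
    have hd : HasDerivAt (fun t => 1 + a * (t - t_s)) a t := by
      simpa using (((hasDerivAt_id t).sub_const t_s).const_mul a).const_add 1
    have h := ((hd.log hu.ne').add (hd.fun_inv hu.ne')).const_mul (α * n_j / β)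
    refine h.congr_deriv ?_
    have hv : v_f = a * (α * L) / β := by rw [ha]; field_simp
    rw [hv]
    generalize 1 + a * (t - t_s) = u at hu
    field_simp
    ring
  rw [intervalIntegral.integral_eq_sub_of_hasDerivAt hF]
  · have h1 : 1 + a * (tstar - t_s) = θ := by linarith
    simp only [h1, sub_self, mul_zero, add_zero, Real.log_one, inv_one]
    ring
  · apply ContinuousOn.intervalIntegrable
    have hc : ContinuousOn (fun t => 1 / (1 + a * (t - t_s))) (Set.uIcc t_s tstar) :=
      continuousOn_const.div (by fun_prop) (fun t ht => (hpos t ht).ne')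
    fun_prop
end

section
/- The cumulative outflow from the start of the rush hour until perimeter control begins equals (α·n_j/β)·(ln 2 − 1/2): let α, β, v_f, L, n_j be positive reals, set a = β·v_f/(α·L), n(t) = n_j·(1 − 1/(1 + a·(t − t_s))) and v(t) = v_f·(1 − n(t)/n_j). Then ∫_{t_s}^{t_s + 1/a} n(t)·v(t)/L dt = (α·n_j/β)·(ln 2 − 1/2). -/
/-- The cumulative outflow from the start of the rush hour until perimeter control begins
equals `(α n_j/β)(ln 2 − 1/2)`: with `a = β v_f/(α L)`,
`n(t) = n_j (1 − 1/(1 + a (t − t_s)))` and `v(t) = v_f (1 − n(t)/n_j)`, one has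
`∫_{t_s}^{t_s + 1/a} n(t) v(t)/L dt = (α n_j/β)(ln 2 − 1/2)`. -/
theorem stmt_9 (α β v_f L n_j t_s a : ℝ)
    (hα : 0 < α) (hβ : 0 < β) (hvf : 0 < v_f) (hL : 0 < L) (hnj : 0 < n_j)
    (ha : a = β * v_f / (α * L)) :
    ∫ t in t_s..(t_s + 1 / a),
        (n_j * (1 - 1 / (1 + a * (t - t_s)))) *
          (v_f * (1 - (n_j * (1 - 1 / (1 + a * (t - t_s)))) / n_j)) / L
      = α * n_j / β * (Real.log 2 - 1 / 2) := by
  have ha0 : 0 < a := by rw [ha]; positivity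
  have hle : t_s ≤ t_s + 1 / a := by
    have : 0 < 1 / a := by positivity
    linarith
  have hpos : ∀ t ∈ Set.uIcc t_s (t_s + 1 / a), 0 < 1 + a * (t - t_s) := by
    intro t ht
    rw [Set.uIcc_of_le hle] at ht
    have := mul_nonneg ha0.le (sub_nonneg.2 ht.1)
    linarith
  have hk : n_j * v_f / L = α * n_j / β * a := by
    rw [ha]; field_simp
  rw [intervalIntegral.integral_eq_sub_of_hasDerivAt
    (f := fun t => α * n_j / β * (Real.log (1 + a * (t - t_s)) + (1 + a * (t - t_s))⁻¹))]
  · have h1 : 1 + a * (t_s + 1 / a - t_s) = 2 := by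
      field_simp; ring
    have h2 : 1 + a * (t_s - t_s) = 1 := by ring
    simp only [h1, h2, Real.log_one]
    ring
  · intro t ht
    have hu := hpos t ht
    have hd : HasDerivAt (fun t => 1 + a * (t - t_s)) a t := by
      simpa using (((hasDerivAt_id t).sub_const t_s).const_mul a).const_add 1
    have h := ((hd.log hu.ne').add (hd.inv hu.ne')).const_mul (α * n_j / β)
    refine h.congr_deriv ?_
    generalize 1 + a * (t - t_s) = u at hu
    have e : n_j * (1 - 1 / u) * (v_f * (1 - n_j * (1 - 1 / u) / n_j)) / L
        = n_j * v_f / L * (1 / u - 1 / u ^ 2) := by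
      field_simp
      ring
    rw [e, hk]
    field_simp
    ring
  · apply ContinuousOn.intervalIntegrable
    have hc : ContinuousOn (fun t => 1 / (1 + a * (t - t_s))) (Set.uIcc t_s (t_s + 1 / a)) :=
      ContinuousOn.div (by fun_prop) (by fun_prop) (fun t ht => (hpos t ht).ne')
    fun_prop
end

section
/- For every real θ > 2, the strict inequality ln θ + 1/θ < θ/4 + ln 2 holds, with equality at θ = 2. -/
/-- For every real `θ > 2`, the strict inequality `ln θ + 1/θ < θ/4 + ln 2` holds, with
equality at `θ = 2`. -/
theorem stmt_13 :
    (∀ θ : ℝ, 2 < θ → Real.log θ + 1 / θ < θ / 4 + Real.log 2) ∧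
    Real.log 2 + 1 / (2 : ℝ) = (2 : ℝ) / 4 + Real.log 2 := by
  refine ⟨fun θ hθ => ?_, by ring⟩
  have hx : 1 < θ / 2 := by linarith
  have h0 : 0 < θ / 2 := by linarith
  have h := Real.self_lt_sinh_iff.2 (Real.log_pos hx)
  rw [Real.sinh_log h0, Real.log_div (by linarith) (by norm_num)] at h
  have e : (θ / 2)⁻¹ = 2 * (1 / θ) := by
    rw [inv_div]; ring
  rw [e] at h
  linarith
end

section
/- Perimeter control strictly reduces the equilibrium bathtub cost whenever hypercongestion exists: let N_s, α, β, γ, n_j be positive reals, suppose θ > 2 satisfies N_s = α·n_j·(1/β + 1/γ)·(ln θ + 1/θ − 1), and suppose θ^p > 2 satisfies N_s = α·n_j·(1/β + 1/γ)·(θ^p/4 + ln 2 − 1). Then θ^p < θ, and hence the equilibrium costs satisfy C^p = θ^p·α·L/v_f < θ·α·L/v_f = C for any positive L, v_f. -/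
/-- Perimeter control strictly reduces the equilibrium bathtub cost whenever hypercongestion
exists: if `θ > 2` satisfies `N_s = α n_j (1/β + 1/γ)(ln θ + 1/θ − 1)` and `θ^p > 2`
satisfies `N_s = α n_j (1/β + 1/γ)(θ^p/4 + ln 2 − 1)`, then `θ^p < θ`, and hence the
equilibrium costs satisfy `θ^p α L/v_f < θ α L/v_f` for any positive `L, v_f`. -/
theorem stmt_14 (N_s α β γ n_j θ θp : ℝ)
    (hNs : 0 < N_s) (hα : 0 < α) (hβ : 0 < β) (hγ : 0 < γ) (hnj : 0 < n_j)
    (hθ : 2 < θ) (hθp : 2 < θp)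
    (heq : N_s = α * n_j * (1 / β + 1 / γ) * (Real.log θ + 1 / θ - 1))
    (heqp : N_s = α * n_j * (1 / β + 1 / γ) * (θp / 4 + Real.log 2 - 1)) :
    θp < θ ∧ ∀ L v_f : ℝ, 0 < L → 0 < v_f →
      θp * (α * L / v_f) < θ * (α * L / v_f) := by
  have hK : 0 < α * n_j * (1 / β + 1 / γ) := by positivity
  have h1 : Real.log θ + 1 / θ - 1 = θp / 4 + Real.log 2 - 1 :=
    mul_left_cancel₀ hK.ne' (heq.symm.trans heqp)
  have hpos : 0 < θ / 2 := by linarith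
  have h2 : Real.log (θ / 2) < Real.sinh (Real.log (θ / 2)) :=
    Real.self_lt_sinh_iff.mpr (Real.log_pos (by linarith))
  rw [Real.sinh_log hpos, Real.log_div (by linarith) (by norm_num), inv_div] at h2
  have h3 : 2 / θ = 2 * (1 / θ) := by ring
  have h4 : θp < θ := by
    rw [h3] at h2
    linarith
  refine ⟨h4, fun L v_f hL hv => ?_⟩
  exact mul_lt_mul_of_pos_right h4 (by positivity)
end

section
/- At the long-run equilibrium, suburban population density strictly decreases with distance: let μ ∈ (0, 1), let α, τ be positive reals and w, C reals, define y(x) = w − C − α·τ·x, let J ⊆ ℝ be an open interval on which y(x) > 0, and let R : ℝ → ℝ be differentiable and positive on J with x ↦ y(x)·R(x)^{−μ} constant on J. Then the population density D(x) = R(x)/(μ·y(x)) satisfies, for every x ∈ J, D′(x) = −α·τ·(1 − μ)·R(x)/(μ·y(x))² < 0. -/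
/-- At the long-run equilibrium, suburban population density strictly decreases with
distance: with `y(x) = w − C − α τ x`, positive differentiable rent `R` on an open interval
`J = (j₁, j₂)` on which `y > 0`, and `y(x) R(x)^{−μ}` constant on `J`, the population
density `D(x) = R(x)/(μ y(x))` satisfies
`D′(x) = −α τ (1 − μ) R(x)/(μ y(x))² < 0` for every `x ∈ J`. -/
theorem stmt_16 (μ α τ w C j₁ j₂ : ℝ) (R : ℝ → ℝ)
    (hμ : μ ∈ Set.Ioo (0 : ℝ) 1) (hα : 0 < α) (hτ : 0 < τ)
    (hy : ∀ x ∈ Set.Ioo j₁ j₂, 0 < w - C - α * τ * x)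
    (hR : ∀ x ∈ Set.Ioo j₁ j₂, 0 < R x)
    (hdiff : ∀ x ∈ Set.Ioo j₁ j₂, DifferentiableAt ℝ R x)
    (hconst : ∃ c : ℝ, ∀ x ∈ Set.Ioo j₁ j₂, (w - C - α * τ * x) * (R x) ^ (-μ) = c) :
    ∀ x ∈ Set.Ioo j₁ j₂,
      HasDerivAt (fun x : ℝ => R x / (μ * (w - C - α * τ * x)))
        (-(α * τ * (1 - μ) * R x / (μ * (w - C - α * τ * x)) ^ 2)) x ∧
      -(α * τ * (1 - μ) * R x / (μ * (w - C - α * τ * x)) ^ 2) < 0 := by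
  obtain ⟨c, hc⟩ := hconst
  obtain ⟨hμ0, hμ1⟩ := hμ
  intro x hx
  have hyx := hy x hx
  have hRx := hR x hx
  have hd := (hdiff x hx).hasDerivAt
  have hyd : HasDerivAt (fun x : ℝ => w - C - α * τ * x) (-(α * τ)) x := by
    simpa using ((hasDerivAt_id x).const_mul (α * τ)).const_sub (w - C)
  have hp := hyd.mul (hd.rpow_const (p := -μ) (Or.inl hRx.ne'))
  have h0 : HasDerivAt ((fun x : ℝ => w - C - α * τ * x) * fun x => R x ^ (-μ)) 0 x := by
    refine (hasDerivAt_const x c).congr_of_eventuallyEq ?_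
    filter_upwards [isOpen_Ioo.mem_nhds hx] with z hz
    exact hc z hz
  have he := hp.unique h0
  have hpow : R x ^ (-μ) = R x ^ (-μ - 1) * R x := by
    rw [Real.rpow_sub_one hRx.ne']
    field_simp
  have hP : 0 < R x ^ (-μ - 1) := Real.rpow_pos_of_pos hRx _
  have hkey : deriv R x * (μ * (w - C - α * τ * x)) = -(α * τ * R x) := by
    rw [hpow] at he
    apply mul_left_cancel₀ hP.ne'
    linear_combination -he
  have hμy : 0 < μ * (w - C - α * τ * x) := mul_pos hμ0 hyx
  constructor
  · refine (hd.div (hyd.const_mul μ) hμy.ne').congr_deriv ?_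
    rw [hkey]
    ring
  · have h1 : 0 < 1 - μ := by linarith
    have : 0 < α * τ * (1 - μ) * R x / (μ * (w - C - α * τ * x)) ^ 2 := by positivity
    linarith
end

section
/- The long-run equilibrium downtown population is N_d = (1/μ)·y_d^{(1−μ)/μ}·(w − C)^{−1/μ}·R₀·A_d: let μ ∈ (0, 1) and let y_d, w − C, R₀, A_d and r_d + r_A be positive reals. Suppose the utility-equalization condition y_d·(r_d + r_A)^{−μ} = (w − C)·R₀^{−μ} holds and the downtown land market clears: (μ·y_d/(r_d + r_A))·N_d = A_d. Then N_d = (1/μ)·y_d^{(1−μ)/μ}·(w − C)^{−1/μ}·R₀·A_d. In particular, N_d is strictly increasing in the equilibrium bathtub cost C (for C < w). -/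
/-- The long-run equilibrium downtown population is
`N_d = (1/μ) y_d^{(1−μ)/μ} (w − C)^{−1/μ} R₀ A_d`: under the utility-equalization condition
`y_d (r_d + r_A)^{−μ} = (w − C) R₀^{−μ}` and downtown land market clearing
`(μ y_d/(r_d + r_A)) N_d = A_d`, the downtown population equals
`(1/μ) y_d^{(1−μ)/μ} (w − C)^{−1/μ} R₀ A_d`; in particular, this quantity is strictly
increasing in the equilibrium bathtub cost `C` (for `C < w`). -/
theorem stmt_18 (μ y_d w C R₀ A_d r_d r_A N_d : ℝ)
    (hμ : μ ∈ Set.Ioo (0 : ℝ) 1) (hyd : 0 < y_d) (hwC : 0 < w - C)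
    (hR₀ : 0 < R₀) (hAd : 0 < A_d) (hrd : 0 < r_d + r_A)
    (heq : y_d * (r_d + r_A) ^ (-μ) = (w - C) * R₀ ^ (-μ))
    (hclear : μ * y_d / (r_d + r_A) * N_d = A_d) :
    N_d = 1 / μ * y_d ^ ((1 - μ) / μ) * (w - C) ^ (-(1 / μ)) * R₀ * A_d ∧
    StrictMonoOn
      (fun c : ℝ => 1 / μ * y_d ^ ((1 - μ) / μ) * (w - c) ^ (-(1 / μ)) * R₀ * A_d)
      (Set.Iio w) := by
  obtain ⟨hμ0, hμ1⟩ := hμ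
  have hμne : μ ≠ 0 := hμ0.ne'
  constructor
  · have key := congrArg (fun t : ℝ => t ^ (1 / μ)) heq
    have hexp : -μ * (1 / μ) = -1 := by field_simp
    rw [Real.mul_rpow hyd.le (Real.rpow_nonneg hrd.le _),
      Real.mul_rpow hwC.le (Real.rpow_nonneg hR₀.le _),
      ← Real.rpow_mul hrd.le, ← Real.rpow_mul hR₀.le, hexp,
      Real.rpow_neg_one, Real.rpow_neg_one] at key
    have hy : y_d ^ ((1 - μ) / μ) = y_d ^ (1 / μ) / y_d := by
      rw [show (1 - μ) / μ = 1 / μ - 1 by field_simp, Real.rpow_sub_one hyd.ne']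
    rw [hy, Real.rpow_neg hwC.le, ← hclear]
    have hP : 0 < (w - C) ^ (1 / μ) := Real.rpow_pos_of_pos hwC _
    generalize (w - C) ^ (1 / μ) = P at *
    generalize y_d ^ (1 / μ) = Q at *
    generalize r_d + r_A = r at *
    have hQ : Q = P * R₀⁻¹ * r := by
      rw [← key]; field_simp
    rw [hQ]
    field_simp
  · intro a ha b hb hab
    have ha' : a < w := ha
    have hb' : b < w := hb
    have hlt : (w - a) ^ (-(1 / μ)) < (w - b) ^ (-(1 / μ)) :=
      Real.rpow_lt_rpow_of_neg (by linarith) (by linarith)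
        (by have : 0 < 1 / μ := by positivity
            linarith)
    have hy := Real.rpow_pos_of_pos hyd ((1 - μ) / μ)
    dsimp only
    gcongr
end
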